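/- arXiv:2209.08134 — 2 statements merged into one kernel-verified Lean document; each statement's English description precedes it below -/
import Mathlib

section
/- If H is a 3-uniform hypergraph on n vertices that contains no pseudocycle of length ℓ for any ℓ ≥ 3 with ℓ not divisible by 3, then e(H) ≤ f(n). -/
/-- `f 0 = f 1 = 0` and, for `n ≥ 2`,
`f n = max over 1 ≤ k ≤ n − 1 of (k choose 2)·(n − k) + f (n − k)`
(here `k = j + 1` ranges over `1, …, n − 1`). -/
def f : ℕ → ℕ
  | 0 => 0
  | 1 => 0
  | n + 2 =>
    (Finset.range (n + 1)).sup fun j =>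
      Nat.choose (j + 1) 2 * (n + 1 - j) + f (n + 1 - j)
  decreasing_by omega
/-- `H` has a pseudocycle of length `ℓ`: a sequence of vertices indexed by `ZMod ℓ`
such that every three cyclically consecutive vertices form an edge of `H`. -/
def HasPseudocycle {V : Type} [DecidableEq V] (H : Finset (Finset V)) (ℓ : ℕ) : Prop :=
  ∃ v : ZMod ℓ → V, ∀ i : ZMod ℓ, ({v i, v (i + 1), v (i + 2)} : Finset V) ∈ H

open Finset

lemma f_step (k m : ℕ) : (k:ℤ) * (k - 1) * m + 2 * (f m : ℤ) ≤ 2 * (f (k + m) : ℤ) := by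
  rcases Nat.eq_zero_or_pos k with rfl | hk
  · simp
  rcases Nat.eq_zero_or_pos m with rfl | hm
  · have : f 0 = 0 := by rw [f]
    simp [this]
  obtain ⟨j, rfl⟩ : ∃ j, k = j + 1 := ⟨k - 1, by omega⟩
  obtain ⟨q, rfl⟩ : ∃ q, m = q + 1 := ⟨m - 1, by omega⟩
  have h1 : Nat.choose (j + 1) 2 * (q + 1) + f (q + 1) ≤ f (j + 1 + (q + 1)) := by
    have e : j + 1 + (q + 1) = (j + q) + 2 := by ring
    rw [e, f]
    have h := Finset.le_sup (s := Finset.range (j + q + 1))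
      (f := fun i => Nat.choose (i + 1) 2 * (j + q + 1 - i) + f (j + q + 1 - i))
      (b := j) (by simp)
    have e2 : j + q + 1 - j = q + 1 := by omega
    simp only [e2] at h
    exact h
  have h2 : (2:ℤ) * (Nat.choose (j + 1) 2 : ℤ) = (j + 1) * j := by
    have := Nat.triangle_succ j
    have h3 : Nat.choose (j+1) 2 * 2 = (j + 1) * j := by
      rw [Nat.choose_two_right]
      simpa using Nat.div_mul_cancel (Nat.even_mul_pred_self (j+1)).two_dvd
    have h4 : ((Nat.choose (j+1) 2 * 2 : ℕ) : ℤ) = (((j + 1) * j : ℕ) : ℤ) := by rw [h3]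
    push_cast at h4
    linarith
  have h5 : ((Nat.choose (j + 1) 2 * (q + 1) + f (q + 1) : ℕ) : ℤ) ≤ (f (j + 1 + (q + 1)) : ℤ) := by
    exact_mod_cast h1
  push_cast at h5 ⊢
  have : ((j:ℤ) + 1) * (j + 1 - 1) * (q + 1) = 2 * (Nat.choose (j + 1) 2 : ℤ) * (q + 1) := by
    rw [h2]; ring
  rw [this]
  nlinarith

section opt
variable {ι : Type} [Fintype ι] [DecidableEq ι]

open Classical in
noncomputable def NN (R : ι → ι → Prop) (z i : ι) : ℤ := if R i z then 1 else 0

open Classical in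
noncomputable def MM (R : ι → ι → Prop) (z i j : ι) : ℤ :=
  if R i z ∧ R j z ∧ ¬ R i j ∧ ¬ R j i then 1 else 0

lemma tourn (R : ι → ι → Prop) (hR : ∀ x y, R x y → ¬ R y x) (a : ι → ℕ) (S : Finset ι) :
    ∑ z ∈ S, ∑ i ∈ S, NN R z i * a z * (a i * (a i - 1)) ≤ 2 * (f (∑ i ∈ S, a i) : ℤ) := by
  induction S using Finset.induction_on_max_value a with
  | empty => simp
  | insert m S hm hmax ih =>
    have hmm : NN R m m = 0 := by
      have : ¬ R m m := fun h => hR _ _ h h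
      simp [NN, this]
    rw [Finset.sum_insert hm, Finset.sum_insert hm, Finset.sum_insert hm, hmm]
    simp_rw [Finset.sum_insert hm]
    rw [Finset.sum_add_distrib]
    have hs := f_step (a m) (∑ i ∈ S, a i)
    have key : ∑ i ∈ S, NN R m i * a m * (a i * ((a i:ℤ) - 1)) +
        ∑ z ∈ S, NN R z m * a z * (a m * ((a m : ℤ) - 1)) ≤
        (a m : ℤ) * (a m - 1) * ((∑ i ∈ S, a i : ℕ) : ℤ) := by
      push_cast
      rw [← Finset.sum_add_distrib, Finset.mul_sum]
      apply Finset.sum_le_sum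
      intro i hi
      have h1 : (a i : ℤ) ≤ a m := by exact_mod_cast hmax i hi
      have h0 : (0 : ℤ) ≤ a i := by positivity
      have hnn : (0:ℤ) ≤ a m * a i * (a m - a i) :=
        mul_nonneg (by positivity) (by linarith)
      have hnn2 : (0:ℤ) ≤ a m * (a m - 1) * a i := by
        rcases Nat.eq_zero_or_pos (a m) with h | h
        · simp [h]
        · have : (1:ℤ) ≤ a m := by exact_mod_cast h
          exact mul_nonneg (mul_nonneg (by positivity) (by linarith)) h0
      by_cases c1 : R i m
      · have c2 := hR _ _ c1
        simp only [NN, c1, c2, if_true, if_false]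
        nlinarith
      · by_cases c2 : R m i
        · simp only [NN, c1, c2, if_true, if_false]
          nlinarith
        · simp only [NN, c1, c2, if_false]
          nlinarith
    linarith

noncomputable def TT (R : ι → ι → Prop) (a : ι → ℤ) : ℤ :=
  ∑ z, ∑ i, ∑ j, MM R z i j * a z * a i * a j - ∑ z, ∑ i, NN R z i * a z * a i

lemma TT_line (R : ι → ι → Prop) (hR : ∀ x y, R x y → ¬ R y x) (a : ι → ℤ) (ha : ∀ i, 0 ≤ a i)
    (p q : ι) (h1 : ¬ R p q) (h2 : ¬ R q p) :
    ∃ L Q : ℤ, 0 ≤ Q ∧ ∀ t : ℤ,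
      TT R (fun x => a x + t * ((if x = p then 1 else 0) - (if x = q then 1 else 0)))
        = TT R a + t * L + t ^ 2 * Q := by
  set d : ι → ℤ := fun x => (if x = p then 1 else 0) - (if x = q then 1 else 0) with hd
  have hirr : ∀ x, ¬ R x x := fun x h => hR _ _ h h
  have hd0 : ∀ x, d x ≠ 0 → x = p ∨ x = q := by
    intro x hx
    by_contra hc
    push Not at hc
    simp [hd, hc.1, hc.2] at hx
  have hadj : ∀ x y, d x ≠ 0 → d y ≠ 0 → ¬ R x y := by
    intro x y hx hy
    rcases hd0 x hx with rfl | rfl <;> rcases hd0 y hy with rfl | rfl <;> simp [*]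
  have hN : ∀ z i, NN R z i * (d z * d i) = 0 := by
    intro z i
    by_cases hz : d z = 0
    · simp [hz]
    by_cases hi : d i = 0
    · simp [hi]
    simp [NN, hadj i z hi hz]
  have hM1 : ∀ z i j, MM R z i j * (d z * d i) = 0 := by
    intro z i j
    by_cases hz : d z = 0
    · simp [hz]
    by_cases hi : d i = 0
    · simp [hi]
    simp [MM, hadj i z hi hz]
  have hM2 : ∀ z i j, MM R z i j * (d z * d j) = 0 := by
    intro z i j
    by_cases hz : d z = 0
    · simp [hz]
    by_cases hi : d j = 0
    · simp [hi]
    simp [MM, hadj j z hi hz]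
  have hM3 : ∀ z i j, MM R z i j * d i * d j = (NN R z i * d i) * (NN R z j * d j) := by
    intro z i j
    by_cases hz : d i = 0
    · simp [hz]
    by_cases hi : d j = 0
    · simp [hi]
    by_cases c1 : R i z <;> by_cases c2 : R j z <;>
      simp [MM, NN, c1, c2, hadj i j hz hi, hadj j i hi hz]
  refine ⟨∑ z, ∑ i, ∑ j, MM R z i j * (d z * a i * a j + a z * d i * a j + a z * a i * d j)
      - ∑ z, ∑ i, NN R z i * (d z * a i + a z * d i),
    ∑ z, a z * ∑ i, ∑ j, MM R z i j * d i * d j, ?_, ?_⟩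
  · apply Finset.sum_nonneg
    intro z _
    apply mul_nonneg (ha z)
    simp_rw [hM3]
    rw [← Finset.sum_mul_sum]
    exact mul_self_nonneg _
  · intro t
    have e1 : ∀ z i j, MM R z i j * (a z + t * d z) * (a i + t * d i) * (a j + t * d j)
        = MM R z i j * a z * a i * a j
          + t * (MM R z i j * (d z * a i * a j + a z * d i * a j + a z * a i * d j))
          + t ^ 2 * (a z * (MM R z i j * d i * d j)) := by
      intro z i j
      linear_combination (t^2 * a j + t^3 * d j) * hM1 z i j + t^2 * a i * hM2 z i j
    have e2 : ∀ z i, NN R z i * (a z + t * d z) * (a i + t * d i)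
        = NN R z i * a z * a i + t * (NN R z i * (d z * a i + a z * d i)) := by
      intro z i
      linear_combination t^2 * hN z i
    simp only [TT]
    change ∑ z, ∑ i, ∑ j, MM R z i j * (a z + t * d z) * (a i + t * d i) * (a j + t * d j) - ∑ z, ∑ i, NN R z i * (a z + t * d z) * (a i + t * d i) = _
    simp_rw [e1, e2, Finset.sum_add_distrib, ← Finset.mul_sum]
    ring

lemma TT_bound (R : ι → ι → Prop) (hR : ∀ x y, R x y → ¬ R y x) (n : ℕ) :
    ∀ (s : ℕ) (a : ι → ℤ), (∀ i, 0 ≤ a i) → ∑ i, a i = n → #{i | a i ≠ 0} = s →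
      TT R a ≤ 2 * (f n : ℤ) := by
  intro s
  induction s using Nat.strong_induction_on with
  | _ s ih =>
  intro a ha hsum hs
  by_cases hc : ∃ p q, p ≠ q ∧ a p ≠ 0 ∧ a q ≠ 0 ∧ ¬ R p q ∧ ¬ R q p
  · obtain ⟨p, q, hpq, hp, hq, h1, h2⟩ := hc
    obtain ⟨L, Q, hQ, hL⟩ := TT_line R hR a ha p q h1 h2
    have hp' : 0 < a p := lt_of_le_of_ne (ha p) (Ne.symm hp)
    have hq' : 0 < a q := lt_of_le_of_ne (ha q) (Ne.symm hq)
    have hsm : ∀ t : ℤ, ∑ x, (a x + t * ((if x = p then 1 else 0) - (if x = q then 1 else 0)))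
        = (n : ℤ) := by
      intro t
      rw [Finset.sum_add_distrib, ← Finset.mul_sum, Finset.sum_sub_distrib]
      simp [hsum]
    have b1 : TT R (fun x => a x + a q * ((if x = p then 1 else 0) - (if x = q then 1 else 0)))
        ≤ 2 * (f n : ℤ) := by
      refine ih _ ?_ _ ?_ (hsm _) rfl
      · rw [← hs]
        apply Finset.card_lt_card
        refine (Finset.ssubset_iff_of_subset ?_).2 ⟨q, by simp [hq], by simp [hpq.symm]⟩
        intro x
        simp only [Finset.mem_filter, Finset.mem_univ, true_and]
        intro hx h0
        rcases eq_or_ne x p with rfl | h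
        · exact hp h0
        rcases eq_or_ne x q with rfl | h'
        · exact hq h0
        simp [h, h', h0] at hx
      · intro x
        rcases eq_or_ne x p with rfl | h
        · simp [hpq]; linarith
        rcases eq_or_ne x q with rfl | h'
        · simp [h]
        simp [h, h', ha]
    have b2 : TT R (fun x => a x + (-a p) * ((if x = p then 1 else 0) - (if x = q then 1 else 0)))
        ≤ 2 * (f n : ℤ) := by
      refine ih _ ?_ _ ?_ (hsm _) rfl
      · rw [← hs]
        apply Finset.card_lt_card
        refine (Finset.ssubset_iff_of_subset ?_).2 ⟨p, by simp [hp], by simp [hpq]⟩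
        intro x
        simp only [Finset.mem_filter, Finset.mem_univ, true_and]
        intro hx h0
        rcases eq_or_ne x p with rfl | h
        · exact hp h0
        rcases eq_or_ne x q with rfl | h'
        · exact hq h0
        simp [h, h', h0] at hx
      · intro x
        rcases eq_or_ne x p with rfl | h
        · simp [hpq]
        rcases eq_or_ne x q with rfl | h'
        · simp [h]; linarith
        simp [h, h', ha]
    rw [hL] at b1 b2
    have c1 := mul_le_mul_of_nonneg_left b1 hp'.le
    have c2 := mul_le_mul_of_nonneg_left b2 hq'.le
    have c3 : 0 ≤ a p * a q * (a p + a q) * Q := by positivity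
    have c4 : (a p + a q) * TT R a ≤ (a p + a q) * (2 * (f n : ℤ)) := by
      linear_combination c1 + c2 + c3
    exact le_of_mul_le_mul_left c4 (by linarith)
  · push Not at hc
    have hirr : ∀ x, ¬ R x x := fun x h => hR _ _ h h
    lift a to ι → ℕ using ha
    have hsum' : ∑ i, a i = n := by
      beta_reduce at hsum
      exact_mod_cast hsum
    have := tourn R hR a Finset.univ
    rw [hsum'] at this
    refine le_trans (le_of_eq ?_) this
    rw [TT, ← Finset.sum_sub_distrib]
    refine Finset.sum_congr rfl fun z _ => ?_
    rw [← Finset.sum_sub_distrib]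
    refine Finset.sum_congr rfl fun i _ => ?_
    rw [Finset.sum_eq_single i]
    · have : MM R z i i = NN R z i := by
        by_cases h : R i z <;> simp [MM, NN, hirr, h]
      rw [this]; ring
    · intro j _ hj
      by_cases h0 : (a i : ℤ) = 0
      · simp [h0]
      by_cases h1 : (a j : ℤ) = 0
      · simp [h1]
      have : MM R z i j = 0 := by
        have := hc i j hj.symm h0 h1
        simp only [MM]
        rw [if_neg]
        tauto
      simp [this]
    · simp

end opt

section walks
variable {V : Type} [DecidableEq V]

def Wk (H : Finset (Finset V)) (k : ℕ) (p q : V × V) : Prop :=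
  ∃ w : ℕ → V, (w 0, w 1) = p ∧ (w k, w (k + 1)) = q ∧
    ∀ i < k, ({w i, w (i + 1), w (i + 2)} : Finset V) ∈ H

lemma Wk.refl (H : Finset (Finset V)) (p : V × V) : Wk H 0 p p :=
  ⟨fun i => if i = 0 then p.1 else p.2, by simp, by simp, by simp⟩

lemma Wk.single {H : Finset (Finset V)} {x y z : V} (h : ({x, y, z} : Finset V) ∈ H) :
    Wk H 1 (x, y) (y, z) :=
  ⟨fun i => if i = 0 then x else if i = 1 then y else z, by simp, by simp, by
    intro i hi
    obtain rfl : i = 0 := by omega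
    simpa using h⟩

lemma Wk.trans {H : Finset (Finset V)} {k l : ℕ} {p q r : V × V} (h1 : Wk H k p q)
    (h2 : Wk H l q r) : Wk H (k + l) p r := by
  obtain ⟨u, hu0, hu1, hu⟩ := h1
  obtain ⟨v, hv0, hv1, hv⟩ := h2
  have a0 : u k = v 0 := by rw [← hv0] at hu1; exact (Prod.ext_iff.1 hu1).1
  have a1 : u (k + 1) = v 1 := by rw [← hv0] at hu1; exact (Prod.ext_iff.1 hu1).2
  let w : ℕ → V := fun i => if i < k then u i else v (i - k)
  have w1 : ∀ i, i ≤ k + 1 → w i = u i := by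
    intro i hi
    simp only [w]
    split_ifs with h
    · rfl
    · obtain rfl | rfl : i = k ∨ i = k + 1 := by omega
      · simp [a0]
      · simp [a1]
  have w2 : ∀ i, w (k + i) = v i := by
    intro i
    simp [w]
  refine ⟨w, ?_, ?_, ?_⟩
  · rw [w1 0 (by omega), w1 1 (by omega), hu0]
  · rw [w2, add_assoc, w2, hv1]
  · intro i hi
    by_cases h : i < k
    · rw [w1 i (by omega), w1 (i+1) (by omega), w1 (i+2) (by omega)]
      exact hu i h
    · obtain ⟨j, rfl⟩ := Nat.exists_eq_add_of_le (not_lt.1 h)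
      rw [add_assoc, add_assoc, w2, w2, w2]
      exact hv j (by omega)

lemma Wk.toCycle {H : Finset (Finset V)} {l : ℕ} (hl : 3 ≤ l) {p : V × V} (h : Wk H l p p) :
    HasPseudocycle H l := by
  obtain ⟨w, h0, h1, h⟩ := h
  have hw := h1.trans h0.symm
  have a0 : w l = w 0 := (Prod.ext_iff.1 hw).1
  have a1 : w (l + 1) = w 1 := (Prod.ext_iff.1 hw).2
  haveI : NeZero l := ⟨by omega⟩
  haveI : Fact (1 < l) := ⟨by omega⟩
  have key : ∀ m, m ≤ l + 1 → w (m % l) = w m := by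
    intro m hm
    rcases Nat.lt_or_ge m l with h | h
    · rw [Nat.mod_eq_of_lt h]
    · obtain rfl | rfl : m = l ∨ m = l + 1 := by omega
      · simp [a0]
      · rw [Nat.add_mod_left, Nat.mod_eq_of_lt (by omega), a1]
  refine ⟨fun i => w i.val, fun i => ?_⟩
  have hi := ZMod.val_lt i
  have e1 : (1 : ZMod l).val = 1 := ZMod.val_one l
  have e2 : (2 : ZMod l).val = 2 := by
    have := ZMod.val_natCast_of_lt (show 2 < l by omega)
    simpa using this
  simp only [ZMod.val_add, e1, e2]
  rw [key _ (by omega), key _ (by omega)]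
  exact h _ hi

lemma closed_dvd {H : Finset (Finset V)}
    (hodd : ∀ ℓ : ℕ, 3 ≤ ℓ → ¬ (3 ∣ ℓ) → ¬ HasPseudocycle H ℓ) {l : ℕ} {p : V × V}
    (h : Wk H l p p) : 3 ∣ l := by
  by_contra hc
  have h4 := (h.trans h).trans (h.trans h)
  exact hodd _ (by omega) (by omega) (h4.toCycle (by omega))

lemma rot {x y z : V} : ({y, z, x} : Finset V) = {x, y, z} := by
  ext; simp; tauto

lemma swp {x y z : V} : ({y, x, z} : Finset V) = {x, y, z} := by
  ext; simp; tauto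

lemma Wk.symm {H : Finset (Finset V)} {k : ℕ} : ∀ {p q : V × V}, Wk H k p q →
    ∃ m, Wk H m q p := by
  induction k with
  | zero =>
    rintro p q ⟨w, h0, h1, -⟩
    obtain rfl : p = q := h0.symm.trans h1
    exact ⟨0, Wk.refl H _⟩
  | succ k ih =>
    rintro p q ⟨w, h0, h1, h⟩
    obtain ⟨m, hm⟩ := ih (p := p) (q := (w k, w (k+1))) ⟨w, h0, rfl, fun i hi => h i (by omega)⟩
    have hk := h k (by omega)
    have s1 : Wk H 1 (w (k+1), w (k+2)) (w (k+2), w k) := Wk.single (by rw [rot]; exact hk)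
    have s2 : Wk H 1 (w (k+2), w k) (w k, w (k+1)) := Wk.single (by rw [← rot]; exact hk)
    subst h1
    exact ⟨_, (s1.trans s2).trans hm⟩

lemma potential {H : Finset (Finset V)}
    (hodd : ∀ ℓ : ℕ, 3 ≤ ℓ → ¬ (3 ∣ ℓ) → ¬ HasPseudocycle H ℓ) :
    ∃ c : V → V → ZMod 3, ∀ x y z, ({x, y, z} : Finset V) ∈ H → c y z = c x y + 1 := by
  let S : Setoid (V × V) :=
    { r := fun p q => ∃ k, Wk H k p q
      iseqv := ⟨fun p => ⟨0, Wk.refl H p⟩, fun ⟨_, h⟩ => h.symm,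
        fun ⟨_, h⟩ ⟨_, h'⟩ => ⟨_, h.trans h'⟩⟩ }
  let rep : V × V → V × V := fun p => (Quotient.mk S p).out
  have hrep : ∀ p, ∃ k, Wk H k (rep p) p := fun p => Quotient.mk_out (s := S) p
  choose k hk using hrep
  refine ⟨fun x y => (k (x, y) : ZMod 3), fun x y z h => ?_⟩
  have s := Wk.single h
  have hr : rep (x, y) = rep (y, z) := by
    have : Quotient.mk S (x, y) = Quotient.mk S (y, z) := Quotient.sound ⟨1, s⟩
    simp only [rep, this]
  have h1 := (hk (x, y)).trans s
  have h2 := hk (y, z)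
  rw [hr] at h1
  obtain ⟨m, hm⟩ := h2.symm
  have d1 := closed_dvd hodd (h1.trans hm)
  have d2 := closed_dvd hodd (h2.trans hm)
  have : k (y, z) ≡ k (x, y) + 1 [MOD 3] := by
    unfold Nat.ModEq; omega
  have := (ZMod.natCast_eq_natCast_iff _ _ _).2 this
  push_cast at this
  exact this

lemma orient {H : Finset (Finset V)} (h3 : ∀ e ∈ H, e.card = 3)
    (hodd : ∀ ℓ : ℕ, 3 ≤ ℓ → ¬ (3 ∣ ℓ) → ¬ HasPseudocycle H ℓ) :
    ∃ R : V → V → Prop, (∀ x y, R x y → ¬ R y x) ∧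
      ∀ e ∈ H, ∃ x y z, x ≠ y ∧ e = {x, y, z} ∧ R x z ∧ R y z ∧ ¬ R x y ∧ ¬ R y x := by
  obtain ⟨c, hc⟩ := potential hodd
  have g1 : ∀ s t : ZMod 3, s - t = 2 → ¬ (t - s = 2) := by decide
  refine ⟨fun x y => c x y - c y x = 2, fun x y => g1 _ _, ?_⟩
  intro e he
  obtain ⟨x, y, z, hxy, hxz, hyz, rfl⟩ := Finset.card_eq_three.1 (h3 e he)
  have e1 := hc x y z he
  have e2 := hc y z x (by rw [rot]; exact he)
  have e3 := hc y x z (by rw [swp]; exact he)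
  have e4 := hc x z y (by convert he using 1; ext; simp; tauto)
  have k1 : c z x = c x y + 2 := by rw [e2, e1]; ring
  have k2 : c z y = c y x + 2 := by rw [e4, e3]; ring
  have tri : ∀ s t : ZMod 3,
      ((t + 1) - (s + 2) = 2 ∧ (s + 1) - (t + 2) = 2 ∧ ¬ s - t = 2 ∧ ¬ t - s = 2) ∨
      (s - t = 2 ∧ (t + 2) - (s + 1) = 2 ∧ ¬ (t + 1) - (s + 2) = 2 ∧ ¬ (s + 2) - (t + 1) = 2) ∨
      (t - s = 2 ∧ (s + 2) - (t + 1) = 2 ∧ ¬ (s + 1) - (t + 2) = 2 ∧ ¬ (t + 2) - (s + 1) = 2) := by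
    decide
  beta_reduce
  rcases tri (c x y) (c y x) with h | h | h
  · exact ⟨x, y, z, hxy, rfl, by rw [e3, k1]; exact h.1, by rw [e1, k2]; exact h.2.1,
      h.2.2.1, h.2.2.2⟩
  · refine ⟨x, z, y, hxz, by ext; simp; tauto, h.1, ?_, ?_, ?_⟩
    · rw [e1, k2]; exact h.2.1
    · rw [e3, k1]; exact h.2.2.1
    · rw [e3, k1]; exact h.2.2.2
  · refine ⟨y, z, x, hyz, by ext; simp; tauto, h.1, ?_, ?_, ?_⟩
    · rw [e3, k1]; exact h.2.1
    · rw [e1, k2]; exact h.2.2.1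
    · rw [e1, k2]; exact h.2.2.2

end walks

/-- If a 3-uniform hypergraph `H` on `n` vertices contains no pseudocycle of length `ℓ`
for any `ℓ ≥ 3` with `3 ∤ ℓ`, then `e(H) ≤ f(n)`. -/
theorem no_odd_pseudocycle_edge_bound (n : ℕ) (H : Finset (Finset (Fin n)))
    (h3 : ∀ e ∈ H, e.card = 3)
    (hodd : ∀ ℓ : ℕ, 3 ≤ ℓ → ¬ (3 ∣ ℓ) → ¬ HasPseudocycle H ℓ) :
    H.card ≤ f n := by
  obtain ⟨R, hR, hH⟩ := orient h3 hodd
  have hb := TT_bound R hR n _ (fun _ => 1) (by simp) (by simp) rfl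
  have hirr : ∀ x, ¬ R x x := fun x h => hR _ _ h h
  classical
  let P : Finset (Fin n × Fin n × Fin n) :=
    {t | t.2.1 ≠ t.2.2 ∧ R t.2.1 t.1 ∧ R t.2.2 t.1 ∧ ¬ R t.2.1 t.2.2 ∧ ¬ R t.2.2 t.2.1}
  have hP : (#P : ℤ) = TT R (fun _ => 1) := by
    rw [TT, ← Finset.sum_sub_distrib, Finset.card_filter, Fintype.sum_prod_type]
    push_cast
    refine Finset.sum_congr rfl fun z _ => ?_
    rw [← Finset.sum_sub_distrib, Fintype.sum_prod_type]
    refine Finset.sum_congr rfl fun i _ => ?_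
    rw [← Finset.add_sum_erase _ _ (Finset.mem_univ i), ← Finset.add_sum_erase univ (fun j => MM R z i j * 1 * 1 * 1) (Finset.mem_univ i)]
    have : MM R z i i = NN R z i := by
        by_cases h : R i z <;> simp [MM, NN, hirr, h]
    rw [this]
    simp only [ne_eq, not_true_eq_false, false_and, if_false, zero_add, mul_one, add_sub_cancel_left]
    refine Finset.sum_congr rfl fun j hj => ?_
    have : i ≠ j := (Finset.ne_of_mem_erase hj).symm
    simp [MM, this]
  have h2 : #H * 2 ≤ #P := by
    let g : Fin n × Fin n × Fin n → Finset (Fin n) := fun t => {t.2.1, t.2.2, t.1}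
    have hle : ∀ e ∈ H, 2 ≤ #{t ∈ P | g t = e} := by
      intro e he
      obtain ⟨x, y, z, hxy, rfl, a1, a2, a3, a4⟩ := hH e he
      have hsub : ({(z, x, y), (z, y, x)} : Finset (Fin n × Fin n × Fin n)) ⊆
          {t ∈ P | g t = {x, y, z}} := by
        intro t ht
        simp only [Finset.mem_insert, Finset.mem_singleton] at ht
        rcases ht with rfl | rfl
        · simp [P, g, *]
        · simp [P, g, *, hxy.symm, swp]
      have := Finset.card_le_card hsub
      rwa [Finset.card_pair (by simp [hxy])] at this
    calc #H * 2 ≤ ∑ e ∈ H, #{t ∈ P | g t = e} := by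
          simpa using Finset.card_nsmul_le_sum H _ 2 hle
      _ ≤ #P := by
          rw [← Finset.card_biUnion]
          · apply Finset.card_le_card
            intro t; simp
          · intro e _ e' _ hne
            rw [Function.onFun, Finset.disjoint_left]
            intro t ht ht'
            simp only [Finset.mem_filter] at ht ht'
            exact hne (ht.2.symm.trans ht'.2)
  have h2' : (#H : ℤ) * 2 ≤ #P := by exact_mod_cast h2
  have : (#H : ℤ) ≤ f n := by linarith
  exact_mod_cast this
end

section
/- There exists ε₀ > 0 such that for every ε ∈ (0, ε₀) there exists n₀ such that the following holds for all n ≥ n₀. Let G be a coloured graph on n vertices whose vertex set can be partitioned into full blue clone-cliques, and suppose c(G) ≥ f(n) − ε²n³. Then G has a full blue clone-clique Q satisfying | |Q| − βn | ≤ 100εn. -/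
/-- A coloured graph on `V`: every pair of distinct vertices is either blue, or red with
an orientation (`Red x y` means red, directed from `x` to `y`). -/
structure ColouredGraph (V : Type) where
  Blue : V → V → Prop
  Red : V → V → Prop
  blue_symm : ∀ x y, Blue x y → Blue y x
  trichotomy : ∀ x y : V, x ≠ y →
    (Blue x y ∧ ¬ Red x y ∧ ¬ Red y x) ∨
    (¬ Blue x y ∧ Red x y ∧ ¬ Red y x) ∨
    (¬ Blue x y ∧ ¬ Red x y ∧ Red y x)

/-- A cherry of `G`: a 3-element set `{x, y, z}` with `Red x y`, `Red x z` and `Blue y z`. -/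
def IsCherry {V : Type} [DecidableEq V] (G : ColouredGraph V) (e : Finset V) : Prop :=
  ∃ x y z : V, x ≠ y ∧ x ≠ z ∧ y ≠ z ∧ e = ({x, y, z} : Finset V) ∧
    G.Red x y ∧ G.Red x z ∧ G.Blue y z

/-- `c(G)`, the number of cherries of `G`. -/
noncomputable def cherryCount {V : Type} [DecidableEq V] (G : ColouredGraph V) : ℕ :=
  Set.ncard {e : Finset V | IsCherry G e}
/-- A full blue clone-clique: all pairs inside `Q` are blue, all pairs between `Q` and its
complement are red, and for each `v ∉ Q` the red edges between `v` and `Q` all have the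
same orientation. -/
def IsFullBlueCloneClique {V : Type} (G : ColouredGraph V) (Q : Finset V) : Prop :=
  (∀ x ∈ Q, ∀ y ∈ Q, x ≠ y → G.Blue x y) ∧
  (∀ v : V, v ∉ Q → ((∀ q ∈ Q, G.Red v q) ∨ (∀ q ∈ Q, G.Red q v)))


lemma aux_identity (s n a : ℝ) (hs : s ^ 2 = 3) :
    a ^ 2 * (n - a) / 2 + (s / 3 - 1 / 2) * (n - a) ^ 3
      = (s / 3 - 1 / 2) * n ^ 3 - s / 3 * (a * (a - (3 - s) / 2 * n) ^ 2) := by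
  have h3 : s ^ 3 = 3 * s := by rw [pow_succ, hs]
  ring_nf
  rw [h3, hs]
  ring

lemma f_ge_term (n k : ℕ) (hk : 1 ≤ k) (hkn : k < n) :
    Nat.choose k 2 * (n - k) + f (n - k) ≤ f n := by
  obtain ⟨m, rfl⟩ : ∃ m, n = m + 2 := ⟨n - 2, by omega⟩
  obtain ⟨j, rfl⟩ : ∃ j, k = j + 1 := ⟨k - 1, by omega⟩
  conv_rhs => rw [f]
  have h := Finset.le_sup (s := Finset.range (m + 1))
    (f := fun j => Nat.choose (j + 1) 2 * (m + 1 - j) + f (m + 1 - j))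
    (b := j) (by simp; omega)
  have e : m + 2 - (j + 1) = m + 1 - j := by omega
  rw [e]
  exact h

lemma f_lower (s : ℝ) (hs : s ^ 2 = 3) (h1 : 1.7 < s) (h2 : s < 1.8) (n : ℕ) :
    (s / 3 - 1 / 2) * (n : ℝ) ^ 3 - 3 * (n : ℝ) ^ 2 ≤ (f n : ℝ) := by
  induction n using Nat.strong_induction_on with
  | _ n ih =>
    by_cases hn : n < 2
    · interval_cases n
      · simp
      · have : (0 : ℝ) ≤ (f 1 : ℝ) := Nat.cast_nonneg _
        norm_num
        linarith
    · push Not at hn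
      have hnR : (2 : ℝ) ≤ n := by exact_mod_cast hn
      set k := ⌊(3 - s) / 2 * (n : ℝ)⌋₊ with hkdef
      have hpos : 0 ≤ (3 - s) / 2 * (n : ℝ) := by
        apply mul_nonneg <;> linarith
      have hk1 : (k : ℝ) ≤ (3 - s) / 2 * (n : ℝ) := Nat.floor_le hpos
      have hk2 : (3 - s) / 2 * (n : ℝ) < k + 1 := Nat.lt_floor_add_one _
      have hk3 : 1 ≤ k := by
        apply Nat.le_floor
        push_cast
        nlinarith
      have hk4 : k < n := by
        have : (k : ℝ) < n := by nlinarith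
        exact_mod_cast this
      have hf := f_ge_term n k hk3 hk4
      have hfR : ((Nat.choose k 2 : ℕ) : ℝ) * ((n : ℝ) - k) + (f (n - k) : ℝ) ≤ f n := by
        rw [← Nat.cast_sub hk4.le]
        exact_mod_cast hf
      have hi := ih (n - k) (by omega)
      rw [Nat.cast_sub hk4.le] at hi
      rw [Nat.cast_choose_two] at hfR
      have hid := aux_identity s n k hs
      have hkR : (1 : ℝ) ≤ k := by exact_mod_cast hk3
      have hd : ((k : ℝ) - (3 - s) / 2 * n) ^ 2 ≤ 1 := by
        rw [sq_le_one_iff_abs_le_one, abs_le]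
        constructor <;> linarith
      have hkn : (k : ℝ) ≤ n := by exact_mod_cast hk4.le
      have e1 : s / 3 * ((k : ℝ) * ((k : ℝ) - (3 - s) / 2 * n) ^ 2) ≤ 0.6 * n := by
        have : (k : ℝ) * ((k : ℝ) - (3 - s) / 2 * n) ^ 2 ≤ n := by nlinarith
        have h0 : 0 ≤ (k : ℝ) * ((k : ℝ) - (3 - s) / 2 * n) ^ 2 := by positivity
        nlinarith
      have e2 : (k : ℝ) * (n - k) / 2 ≤ n ^ 2 / 8 := by
        nlinarith [sq_nonneg ((n : ℝ) - 2 * k)]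
      have e3 : ((n : ℝ) - k) ≤ 0.9 * n := by nlinarith
      have e5 : ((n : ℝ) - k) ^ 2 ≤ 0.81 * n ^ 2 := by
        nlinarith
      nlinarith

lemma W_split {ι : Type} [DecidableEq ι] (a : ι → ℝ) (s : Finset ι) (m : ι) (hm : m ∈ s)
    (hmax : ∀ i ∈ s, a i ≤ a m) :
    ∑ i ∈ s, ∑ j ∈ s, (if i = j then 0 else a i * a j * max (a i) (a j) / 4)
      = a m ^ 2 * (∑ i ∈ s, a i - a m) / 2
        + ∑ i ∈ s.erase m, ∑ j ∈ s.erase m,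
            (if i = j then 0 else a i * a j * max (a i) (a j) / 4) := by
  have key : ∀ g : ι → ℝ, ∑ i ∈ s, g i = g m + ∑ i ∈ s.erase m, g i := fun g =>
    (Finset.add_sum_erase s g hm).symm
  rw [key, key a]
  simp_rw [key (fun j => if _ = j then (0 : ℝ) else _)]
  rw [Finset.sum_add_distrib]
  have h1 : ∑ j ∈ s.erase m, (if m = j then 0 else a m * a j * max (a m) (a j) / 4)
      = a m ^ 2 / 4 * ∑ j ∈ s.erase m, a j := by
    rw [Finset.mul_sum]
    refine Finset.sum_congr rfl fun j hj => ?_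
    rw [Finset.mem_erase] at hj
    rw [if_neg (Ne.symm hj.1), max_eq_left (hmax j hj.2)]
    ring
  have h2 : ∑ j ∈ s.erase m, (if j = m then 0 else a j * a m * max (a j) (a m) / 4)
      = a m ^ 2 / 4 * ∑ j ∈ s.erase m, a j := by
    rw [Finset.mul_sum]
    refine Finset.sum_congr rfl fun j hj => ?_
    rw [Finset.mem_erase] at hj
    rw [if_neg hj.1, max_eq_right (hmax j hj.2)]
    ring
  rw [h1, h2]
  simp
  ring

lemma W_le {ι : Type} [DecidableEq ι] (r : ℝ) (hr : r ^ 2 = 3) (hr1 : 1.7 < r) (a : ι → ℝ) (ha : ∀ i, 0 ≤ a i)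
    (k : ℕ) : ∀ s : Finset ι, s.card = k →
    ∑ i ∈ s, ∑ j ∈ s, (if i = j then 0 else a i * a j * max (a i) (a j) / 4)
      ≤ (r / 3 - 1 / 2) * (∑ i ∈ s, a i) ^ 3 := by
  induction k with
  | zero =>
    intro s hs
    rw [Finset.card_eq_zero] at hs
    subst hs
    simp
  | succ k ih =>
    intro s hs
    obtain ⟨m, hm, hmax⟩ := Finset.exists_max_image s a (Finset.card_pos.mp (by omega))
    rw [W_split a s m hm hmax]
    have h := ih (s.erase m) (by rw [Finset.card_erase_of_mem hm]; omega)
    have e : ∑ i ∈ s.erase m, a i = ∑ i ∈ s, a i - a m := by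
      rw [← Finset.add_sum_erase s a hm]; ring
    rw [e] at h
    have hid := aux_identity r (∑ i ∈ s, a i) (a m) hr
    have h0 : 0 ≤ r / 3 * (a m * (a m - (3 - r) / 2 * ∑ i ∈ s, a i) ^ 2) := by
      have := ha m
      positivity
    linarith

lemma W_le' {ι : Type} [DecidableEq ι] (a : ι → ℝ) (ha : ∀ i, 0 ≤ a i) (s : Finset ι) (m : ι)
    (hm0 : 0 ≤ a m) (hmax : ∀ i ∈ s, a i ≤ a m) :
    ∑ i ∈ s, ∑ j ∈ s, (if i = j then 0 else a i * a j * max (a i) (a j) / 4)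
      ≤ a m / 4 * (∑ i ∈ s, a i) ^ 2 := by
  rw [pow_two, Finset.sum_mul_sum, Finset.mul_sum]
  refine Finset.sum_le_sum fun i hi => ?_
  rw [Finset.mul_sum]
  refine Finset.sum_le_sum fun j hj => ?_
  have h0 : 0 ≤ a i * a j := mul_nonneg (ha i) (ha j)
  have h1 : max (a i) (a j) ≤ a m := max_le (hmax i hi) (hmax j hj)
  split_ifs
  · positivity
  · nlinarith

lemma red_asymm {V : Type} (G : ColouredGraph V) {x y : V} (hxy : x ≠ y)
    (h : G.Red x y) : ¬ G.Red y x := by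
  rcases G.trichotomy x y hxy with h' | h' | h' <;> tauto

lemma red_not_blue {V : Type} (G : ColouredGraph V) {x y : V} (hxy : x ≠ y)
    (h : G.Red x y) : ¬ G.Blue x y := by
  rcases G.trichotomy x y hxy with h' | h' | h' <;> tauto

open Classical in
lemma cherry_le {n t : ℕ} (G : ColouredGraph (Fin n)) (P : Fin t → Finset (Fin n))
    (hP : ∀ i, IsFullBlueCloneClique G (P i)) (hv : ∀ v : Fin n, ∃! i, v ∈ P i) :
    (cherryCount G : ℝ) ≤ ∑ i, ∑ j, (if i = j then 0 else
      ((P i).card : ℝ) * (P j).card * max ((P i).card : ℝ) (P j).card / 4) := by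
  set D : Fin t → Fin t → Prop := fun i j => i ≠ j ∧ ∃ x ∈ P i, ∃ y ∈ P j, G.Red x y with hD
  have huniq : ∀ {v i j}, v ∈ P i → v ∈ P j → i = j := fun {v i j} h1 h2 =>
    (hv v).unique h1 h2
  have hne : ∀ {x y i j}, i ≠ j → x ∈ P i → y ∈ P j → x ≠ y := by
    rintro x y i j hij hx hy rfl
    exact hij (huniq hx hy)
  have hDasymm : ∀ i j, D i j → ¬ D j i := by
    rintro i j ⟨hij, x, hx, y, hy, hxy⟩ ⟨_, y', hy', x', hx', hyx⟩
    have hxall : G.Red x y' := by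
      rcases (hP j).2 x (fun h => hij (huniq hx h)) with h | h
      · exact h y' hy'
      · exact absurd (h y hy) (red_asymm G (hne hij hx hy) hxy)
    have hyall : G.Red y' x := by
      rcases (hP i).2 y' (fun h => hij (huniq h hy')) with h | h
      · exact h x hx
      · exact absurd (h x' hx') (red_asymm G (hne hij.symm hy' hx') hyx)
    exact red_asymm G (hne hij hx hy') hxall hyall
  set S : Finset (Finset (Fin n)) :=
    (Finset.univ.filter fun p : Fin t × Fin t => D p.1 p.2).biUnion fun p =>
      (P p.1 ×ˢ (P p.2).powersetCard 2).image fun q => insert q.1 q.2 with hS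
  have hsub : {e : Finset (Fin n) | IsCherry G e} ⊆ (S : Set (Finset (Fin n))) := by
    rintro e ⟨x, y, z, hxy, hxz, hyz, rfl, rxy, rxz, byz⟩
    obtain ⟨i, hi, -⟩ := hv x
    obtain ⟨j, hj, -⟩ := hv y
    have hz : z ∈ P j := by
      by_contra hz
      rcases (hP j).2 z hz with h | h
      · exact red_not_blue G hyz.symm (h y hj) (G.blue_symm _ _ byz)
      · exact red_not_blue G hyz (h y hj) byz
    have hij : i ≠ j := by
      rintro rfl
      exact red_not_blue G hxy rxy ((hP i).1 x hi y hj hxy)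
    rw [Finset.mem_coe, hS, Finset.mem_biUnion]
    refine ⟨(i, j), by simpa using ⟨hij, x, hi, y, hj, rxy⟩, ?_⟩
    rw [Finset.mem_image]
    refine ⟨(x, {y, z}), ?_, rfl⟩
    rw [Finset.mem_product, Finset.mem_powersetCard]
    refine ⟨hi, ?_, Finset.card_pair hyz⟩
    intro w hw
    simp only [Finset.mem_insert, Finset.mem_singleton] at hw
    rcases hw with rfl | rfl <;> assumption
  have hcard : cherryCount G ≤ ∑ p ∈ Finset.univ.filter (fun p : Fin t × Fin t => D p.1 p.2),
      (P p.1).card * (P p.2).card.choose 2 := by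
    have h1 : cherryCount G ≤ S.card := by
      rw [← Set.ncard_coe_finset S]
      exact Set.ncard_le_ncard hsub (Finset.finite_toSet S)
    refine h1.trans (Finset.card_biUnion_le.trans (Finset.sum_le_sum fun p _ => ?_))
    refine Finset.card_image_le.trans ?_
    rw [Finset.card_product, Finset.card_powersetCard]
  set M : Fin t → Fin t → ℝ := fun i j =>
    ((P i).card : ℝ) * (P j).card * max ((P i).card : ℝ) (P j).card / 4 with hM
  have hM0 : ∀ i j, 0 ≤ M i j := fun i j => by rw [hM]; positivity
  have hMs : ∀ i j, M i j = M j i := fun i j => by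
    simp only [hM]; rw [max_comm]; ring
  have hA : (cherryCount G : ℝ) ≤ ∑ i, ∑ j, (if D i j then 2 * M i j else 0) := by
    have h2 : (cherryCount G : ℝ) ≤ ((∑ p ∈ Finset.univ.filter
      (fun p : Fin t × Fin t => D p.1 p.2), (P p.1).card * (P p.2).card.choose 2 : ℕ) : ℝ) := by
      exact_mod_cast hcard
    refine h2.trans ?_
    rw [← Fintype.sum_prod_type' (f := fun i j => if D i j then 2 * M i j else 0),
      ← Finset.sum_filter]
    push_cast
    refine Finset.sum_le_sum fun p _ => ?_
    rw [Nat.cast_choose_two]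
    simp only [hM]
    have ha : (0 : ℝ) ≤ (P p.1).card := Nat.cast_nonneg _
    have hb : (0 : ℝ) ≤ (P p.2).card := Nat.cast_nonneg _
    have hm : ((P p.2).card : ℝ) - 1 ≤ max ((P p.1).card : ℝ) (P p.2).card := by
      have := le_max_right ((P p.1).card : ℝ) (P p.2).card
      linarith
    have := mul_le_mul_of_nonneg_left hm (mul_nonneg ha hb)
    linarith
  have hB : ∑ i, ∑ j, (if D i j then 2 * M i j else 0)
      = ∑ i, ∑ j, (if D j i then 2 * M i j else 0) := by
    rw [Finset.sum_comm]
    refine Finset.sum_congr rfl fun i _ => Finset.sum_congr rfl fun j _ => ?_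
    rw [hMs]
  have hC : ∑ i, ∑ j, (if D i j then 2 * M i j else 0)
      + ∑ i, ∑ j, (if D j i then 2 * M i j else 0)
      ≤ 2 * ∑ i, ∑ j, (if i = j then 0 else M i j) := by
    rw [← Finset.sum_add_distrib, Finset.mul_sum]
    refine Finset.sum_le_sum fun i _ => ?_
    rw [← Finset.sum_add_distrib, Finset.mul_sum]
    refine Finset.sum_le_sum fun j _ => ?_
    have := hM0 i j
    by_cases hij : i = j
    · subst hij
      have : ¬ D i i := fun h => h.1 rfl
      simp [this]
    · by_cases h1 : D i j
      · simp [h1, hDasymm i j h1, hij]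
      · by_cases h2 : D j i
        · simp [h1, h2, hij]
        · simp [h1, h2, hij, this]
  linarith

lemma sum_card {n t : ℕ} (P : Fin t → Finset (Fin n)) (hv : ∀ v : Fin n, ∃! i, v ∈ P i) :
    ∑ i, ((P i).card : ℝ) = n := by
  have h : ∑ i, (P i).card = n := by
    rw [← Finset.card_biUnion]
    · have : Finset.univ.biUnion P = Finset.univ := by
        ext v
        obtain ⟨i, hi, -⟩ := hv v
        simpa using ⟨i, hi⟩
      rw [this]
      simp
    · intro i _ j _ hij
      rw [Function.onFun, Finset.disjoint_left]
      intro v h1 h2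
      exact hij ((hv v).unique h1 h2)
  exact_mod_cast h

/-- If the vertices of a coloured graph `G` on `n` vertices can be partitioned into full
blue clone-cliques and `c(G) ≥ f(n) − ε²n³`, then `G` has a full blue clone-clique `Q`
with `||Q| − βn| ≤ 100εn`, where `β = (3 − √3)/2`. -/
theorem clone_clique_size :
    ∃ ε₀ : ℝ, 0 < ε₀ ∧ ∀ ε : ℝ, 0 < ε → ε < ε₀ →
      ∃ n₀ : ℕ, ∀ n : ℕ, n₀ ≤ n → ∀ G : ColouredGraph (Fin n),
        (∃ t : ℕ, ∃ P : Fin t → Finset (Fin n),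
          (∀ i, IsFullBlueCloneClique G (P i)) ∧ (∀ v : Fin n, ∃! i, v ∈ P i)) →
        (cherryCount G : ℝ) ≥ (f n : ℝ) - ε ^ 2 * (n : ℝ) ^ 3 →
        ∃ Q : Finset (Fin n), IsFullBlueCloneClique G Q ∧
          |(Q.card : ℝ) - (3 - Real.sqrt 3) / 2 * (n : ℝ)| ≤ 100 * ε * (n : ℝ) := by
  classical
  refine ⟨1 / 100, by norm_num, fun ε hε hε1 => ⟨⌈3 / ε ^ 2⌉₊ + 1, ?_⟩⟩
  intro n hn G ⟨t, P, hP, hv⟩ hc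
  set s := Real.sqrt 3 with hsdef
  have hs : s ^ 2 = 3 := Real.sq_sqrt (by norm_num)
  have hs0 : 0 ≤ s := Real.sqrt_nonneg 3
  have h1 : 1.73 < s := by nlinarith
  have h2 : s < 1.8 := by nlinarith
  have hn1 : 3 / ε ^ 2 ≤ (n : ℝ) := by
    refine (Nat.le_ceil _).trans ?_
    exact_mod_cast (Nat.le_succ _).trans hn
  have hnpos : 0 < n := by omega
  have hnR : (0 : ℝ) < n := by exact_mod_cast hnpos
  have hn3 : 3 * (n : ℝ) ^ 2 ≤ ε ^ 2 * (n : ℝ) ^ 3 := by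
    rw [div_le_iff₀ (by positivity)] at hn1
    have : 0 ≤ (n : ℝ) ^ 2 := by positivity
    nlinarith
  have hf := f_lower s hs (by linarith) h2 n
  have hcl := cherry_le G P hP hv
  have hsum := sum_card P hv
  obtain ⟨i0, -, -⟩ := hv ⟨0, hnpos⟩
  obtain ⟨m, -, hmax⟩ := Finset.exists_max_image Finset.univ (fun i => ((P i).card : ℝ))
    ⟨i0, Finset.mem_univ _⟩
  refine ⟨P m, hP m, ?_⟩
  have ha0 : ∀ i, (0 : ℝ) ≤ ((P i).card : ℝ) := fun i => Nat.cast_nonneg _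
  have b1 := W_le' (fun i => ((P i).card : ℝ)) ha0 Finset.univ m (ha0 m) hmax
  have b2 := W_split (fun i => ((P i).card : ℝ)) Finset.univ m (Finset.mem_univ _) hmax
  have b3 := W_le s hs (by linarith) (fun i => ((P i).card : ℝ)) ha0 _
    (Finset.univ.erase m) rfl
  have e : ∑ i ∈ Finset.univ.erase m, ((P i).card : ℝ) = n - (P m).card := by
    rw [← hsum, ← Finset.add_sum_erase Finset.univ _ (Finset.mem_univ m)]; ring
  simp only [e] at b3
  simp only [hsum] at b1 b2
  have hid := aux_identity s n (P m).card hs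
  set a : ℝ := ((P m).card : ℝ) with hadef
  have c1 : (s / 3 - 1 / 2) * (n : ℝ) ^ 3 - 2 * (ε ^ 2 * (n : ℝ) ^ 3) ≤ a / 4 * (n : ℝ) ^ 2 := by
    linarith
  have c2 : s / 3 * (a * (a - (3 - s) / 2 * n) ^ 2) ≤ 2 * (ε ^ 2 * (n : ℝ) ^ 3) := by
    linarith
  have hε2 : ε ^ 2 ≤ 0.0001 := by nlinarith
  have ca : 0.2 * (n : ℝ) ≤ a := by
    have hn2 : 0 < (n : ℝ) ^ 2 := by positivity
    have h5 : (0.2 * (n : ℝ)) * (n : ℝ) ^ 2 ≤ a * (n : ℝ) ^ 2 := by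
      have hn3' : 0 < (n : ℝ) ^ 3 := by positivity
      nlinarith
    exact le_of_mul_le_mul_right h5 hn2
  have c3 : (a - (3 - s) / 2 * n) ^ 2 ≤ 20 * ε ^ 2 * (n : ℝ) ^ 2 := by
    have hsq : 0 ≤ (a - (3 - s) / 2 * n) ^ 2 := sq_nonneg _
    have h6 : 0.2 * (n : ℝ) * (a - (3 - s) / 2 * n) ^ 2 ≤ a * (a - (3 - s) / 2 * n) ^ 2 :=
      mul_le_mul_of_nonneg_right ca hsq
    have h8 : 0 ≤ a * (a - (3 - s) / 2 * n) ^ 2 := mul_nonneg (ha0 m) hsq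
    have h7 : 0.5 * (a * (a - (3 - s) / 2 * n) ^ 2)
        ≤ s / 3 * (a * (a - (3 - s) / 2 * n) ^ 2) :=
      mul_le_mul_of_nonneg_right (by linarith) h8
    have h9 : (n : ℝ) * (a - (3 - s) / 2 * n) ^ 2 ≤ n * (20 * ε ^ 2 * (n : ℝ) ^ 2) := by
      have : n * (20 * ε ^ 2 * (n : ℝ) ^ 2) = 20 * (ε ^ 2 * (n : ℝ) ^ 3) := by ring
      rw [this]
      linarith
    exact le_of_mul_le_mul_left h9 hnR
  apply abs_le_of_sq_le_sq
  · have : 0 ≤ ε ^ 2 * (n : ℝ) ^ 2 := by positivity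
    have e2 : (100 * ε * (n : ℝ)) ^ 2 = 10000 * (ε ^ 2 * (n : ℝ) ^ 2) := by ring
    rw [e2]
    linarith
  · positivity
end
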